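/- Let {h_i}_{i∈I} be an IFS generating a parabolic Cantor set. Then the semigroup {h_i : i ∈ I^*} of all finite compositions contains a map h_{i_0} with sup_{x∈[0,1]} |h_{i_0}'(x)| < 1; consequently sup_{j∈I^*} sup_{x∈[0,1]} |h_{j i_0}'(x)| ≤ sup_{x∈[0,1]} |h_{i_0}'(x)| < 1. -/

import Mathlib

open Set Filter MeasureTheory Metric Topology
open scoped ENNReal NNReal

/-- Composition of the maps along a finite word: `h_{i₁…iₙ} = h_{i₁} ∘ ⋯ ∘ h_{iₙ}`. -/
def wMap {I : Type} (h : I → ℝ → ℝ) : List I → ℝ → ℝ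
  | [] => id
  | a :: t => h a ∘ wMap h t

/-- Derivative cocycle of the composition along a finite word (chain rule). -/
def wDeriv {I : Type} (h h' : I → ℝ → ℝ) : List I → ℝ → ℝ
  | [] => fun _ => 1
  | a :: t => fun x => h' a (wMap h t x) * wDeriv h h' t x

/-- `‖h_w'‖_∞`, the sup of `|h_w'|` over `[0,1]`. -/
noncomputable def supD {I : Type} (h h' : I → ℝ → ℝ) (w : List I) : ℝ :=
  ⨆ x : Icc (0:ℝ) 1, |wDeriv h h' w x|

/-- The cylinder of infinite words beginning with the finite word `w`. -/
def cyl {I : Type} (w : List I) : Set (ℕ → I) := {ω | ∀ k : Fin w.length, ω k = w.get k}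

/-- A parabolic IFS on `[0,1]` satisfying A1', A2', A3' (parabolic Cantor set system). -/
structure PCantorIFS (I : Type) [Fintype I] where
  h : I → ℝ → ℝ
  h' : I → ℝ → ℝ
  αh : ℝ
  αh_pos : 0 < αh
  card : 2 ≤ Fintype.card I
  maps : ∀ i, MapsTo (h i) (Icc (0:ℝ) 1) (Icc (0:ℝ) 1)
  contract : ∀ i, ∀ x ∈ Icc (0:ℝ) 1, ∀ y ∈ Icc (0:ℝ) 1, x ≠ y → |h i x - h i y| < |x - y|
  hasDeriv : ∀ i, ∀ x ∈ Icc (0:ℝ) 1, HasDerivWithinAt (h i) (h' i x) (Icc (0:ℝ) 1) x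
  holder : ∃ C > 0, ∀ i, ∀ x ∈ Icc (0:ℝ) 1, ∀ y ∈ Icc (0:ℝ) 1,
      |h' i x - h' i y| ≤ C * |x - y| ^ αh
  nonzero : ∀ i, ∀ x ∈ Icc (0:ℝ) 1, h' i x ≠ 0
  sep : ∀ i j, i ≠ j → Disjoint (h i '' Ioo (0:ℝ) 1) (h j '' Ioo (0:ℝ) 1)

/-- The induced (hyperbolic) alphabet `I_∞ = {j i₀ : j ∈ (I ∖ {i₀})^*} ∪ {i₀}`. -/
def Iinf {I : Type} (i0 : I) : Set (List I) :=
  {w | ∃ j : List I, (∀ a ∈ j, a ≠ i0) ∧ w = j ++ [i0]}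

/-- Finite concatenations of words from `I_∞`. -/
def IinfStar {I : Type} (i0 : I) : Set (List I) :=
  {w | ∃ L : List (List I), (∀ u ∈ L, u ∈ Iinf i0) ∧ w = L.flatten}

/-- The truncated induced alphabet `I_N`. -/
def IN {I : Type} (i0 : I) (N : ℕ) : Set (List I) :=
  {w | w ∈ Iinf i0 ∧ w.length ≤ N}

/-- The weak quasi-Bernoulli property. -/
def WeakQB {I : Type} [MeasurableSpace I] (P : Measure (ℕ → I)) : Prop :=
  ∃ c : ℕ → ℝ, (∀ n, 0 < c n) ∧
    Tendsto (fun n : ℕ => c n ^ ((n : ℝ)⁻¹)) atTop (𝓝 1) ∧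
    ∀ L : List (List I), (∀ w ∈ L, w ≠ []) →
      ((L.map fun w => c w.length).prod)⁻¹ * (L.map fun w => (P (cyl w)).toReal).prod
          ≤ (P (cyl L.flatten)).toReal ∧
        (P (cyl L.flatten)).toReal
          ≤ (L.map fun w => c w.length).prod * (L.map fun w => (P (cyl w)).toReal).prod

/-- The quasi-Bernoulli property restricted to concatenations of words from `I_∞`. -/
def QBonInf {I : Type} [MeasurableSpace I] (P : Measure (ℕ → I)) (i0 : I) : Prop :=
  ∃ c : ℝ, 1 ≤ c ∧ ∀ u ∈ IinfStar i0, ∀ v ∈ IinfStar i0,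
    c⁻¹ * ((P (cyl u)).toReal * (P (cyl v)).toReal) ≤ (P (cyl (u ++ v))).toReal ∧
    (P (cyl (u ++ v))).toReal ≤ c * ((P (cyl u)).toReal * (P (cyl v)).toReal)

/-- The partition sums `∑_{i ∈ I^n} ℙ([i])^q ‖h_i'‖_∞^s` over the full alphabet. -/
noncomputable def pSum {I : Type} [Fintype I] [MeasurableSpace I]
    (P : Measure (ℕ → I)) (h h' : I → ℝ → ℝ) (n : ℕ) (s q : ℝ) : ℝ :=
  ∑ w : Fin n → I, (P (cyl (List.ofFn w))).toReal ^ q * supD h h' (List.ofFn w) ^ s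

/-- The partition sums over `n`-fold concatenations of words from an alphabet `J` of
finite words. -/
noncomputable def zSum {I : Type} [MeasurableSpace I]
    (P : Measure (ℕ → I)) (h h' : I → ℝ → ℝ) (J : Set (List I)) (n : ℕ) (s q : ℝ) : ℝ :=
  ∑' w : Fin n → ↥J,
    (P (cyl (List.flatten (List.ofFn fun k => ((w k : List I)))))).toReal ^ q *
      supD h h' (List.flatten (List.ofFn fun k => ((w k : List I)))) ^ s

/-- `x ^ q` with the convention `0^0 = 0` used for moment sums. -/
noncomputable def pw (a q : ℝ) : ℝ := if a = 0 then 0 else a ^ q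

/-- The `q`-th moment sum of a measure on `ℝ` over the closed intervals of the `δ`-mesh. -/
noncomputable def Dq1 (ν : Measure ℝ) (q δ : ℝ) : ℝ :=
  ∑' k : ℤ, pw ((ν (Icc ((k : ℝ) * δ) (((k : ℝ) + 1) * δ))).toReal) q

/-- Number of intervals of the `δ`-mesh which intersect `F ⊆ ℝ`. -/
noncomputable def covCount (F : Set ℝ) (δ : ℝ) : ℕ :=
  Set.ncard {k : ℤ | (Icc ((k : ℝ) * δ) (((k : ℝ) + 1) * δ) ∩ F).Nonempty}

lemma wMap_append {I : Type} (h : I → ℝ → ℝ) (v u : List I) (x : ℝ) :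
    wMap h (v ++ u) x = wMap h v (wMap h u x) := by
  induction v with
  | nil => rfl
  | cons a t ih => simp [wMap, ih]

lemma wDeriv_append {I : Type} (h h' : I → ℝ → ℝ) (v u : List I) (x : ℝ) :
    wDeriv h h' (v ++ u) x = wDeriv h h' v (wMap h u x) * wDeriv h h' u x := by
  induction v with
  | nil => simp [wDeriv]
  | cons a t ih => simp [wDeriv, ih, wMap_append, mul_assoc]

/-- A continuous injective function maps `[0,1]` into the interval spanned by the images of the
endpoints, and maps `(0,1)` onto the interior of that interval. -/
lemma image_subset_uIcc_and_uIoo_subset_image {f : ℝ → ℝ} (hc : ContinuousOn f (Icc 0 1))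
    (hi : InjOn f (Icc 0 1)) :
    f '' Icc 0 1 ⊆ uIcc (f 0) (f 1) ∧ uIoo (f 0) (f 1) ⊆ f '' Ioo 0 1 := by
  have h0 : (0 : ℝ) ∈ Icc (0 : ℝ) 1 := by simp
  have h1 : (1 : ℝ) ∈ Icc (0 : ℝ) 1 := by simp
  rcases hc.strictMonoOn_of_injOn_Icc' zero_le_one hi with hm | hm
  · have hle : f 0 ≤ f 1 := hm.monotoneOn h0 h1 zero_le_one
    rw [uIcc_of_le hle, uIoo_of_le hle]
    refine ⟨?_, intermediate_value_Ioo zero_le_one hc⟩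
    rintro _ ⟨x, hx, rfl⟩
    exact ⟨hm.monotoneOn h0 hx hx.1, hm.monotoneOn hx h1 hx.2⟩
  · have hle : f 1 ≤ f 0 := hm.antitoneOn h0 h1 zero_le_one
    rw [uIcc_of_ge hle, uIoo_of_ge hle]
    refine ⟨?_, intermediate_value_Ioo' zero_le_one hc⟩
    rintro _ ⟨x, hx, rfl⟩
    exact ⟨hm.antitoneOn hx h1 hx.2, hm.antitoneOn h0 hx hx.1⟩

/-- Exact mean value theorem in terms of absolute values, on a subinterval of `[0,1]`. -/
lemma exists_mem_uIcc_abs_sub_eq {f f' : ℝ → ℝ}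
    (hf : ∀ x ∈ Icc (0 : ℝ) 1, HasDerivWithinAt f (f' x) (Icc 0 1) x)
    {x y : ℝ} (hx : x ∈ Icc (0 : ℝ) 1) (hy : y ∈ Icc (0 : ℝ) 1) :
    ∃ c ∈ uIcc x y, |f y - f x| = |f' c| * |y - x| := by
  wlog hxy : x ≤ y generalizing x y
  · obtain ⟨c, hc, h⟩ := this hy hx (le_of_not_ge hxy)
    exact ⟨c, uIcc_comm y x ▸ hc, by rw [abs_sub_comm, h, abs_sub_comm x y]⟩
  rcases hxy.eq_or_lt with rfl | hlt
  · exact ⟨x, by simp, by simp⟩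
  have hsub : Icc x y ⊆ Icc (0 : ℝ) 1 := Icc_subset_Icc hx.1 hy.2
  obtain ⟨c, hc, h⟩ := exists_hasDerivAt_eq_slope f f' hlt
    (fun z hz => ((hf z (hsub hz)).continuousWithinAt).mono hsub)
    (fun z hz => (hf z (hsub (Ioo_subset_Icc_self hz))).hasDerivAt
      (Icc_mem_nhds (hx.1.trans_lt hz.1) (hz.2.trans_le hy.2)))
  refine ⟨c, by rw [uIcc_of_le hxy]; exact Ioo_subset_Icc_self hc, ?_⟩
  have : y - x ≠ 0 := (sub_pos.2 hlt).ne'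
  rw [h, ← abs_mul, div_mul_cancel₀ _ this]

namespace PCantorIFS

variable {I : Type} [Fintype I] (S : PCantorIFS I)

lemma continuousOn_h (i : I) : ContinuousOn (S.h i) (Icc 0 1) :=
  fun x hx => (S.hasDeriv i x hx).continuousWithinAt

lemma injOn_h (i : I) : InjOn (S.h i) (Icc 0 1) := by
  intro x hx y hy hxy
  by_contra hne
  obtain ⟨c, hc, h⟩ := exists_mem_uIcc_abs_sub_eq (S.hasDeriv i) hx hy
  rw [hxy, sub_self, abs_zero, eq_comm, mul_eq_zero, abs_eq_zero, abs_eq_zero] at h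
  exact h.elim (S.nonzero i c (uIcc_subset_Icc hx hy hc)) (fun h => hne (sub_eq_zero.1 h).symm)

lemma mapsTo_Ioo_h (i : I) : MapsTo (S.h i) (Ioo 0 1) (Ioo 0 1) := by
  intro x hx
  have hx' := Ioo_subset_Icc_self hx
  have hm : Icc (0 : ℝ) 1 ∈ 𝓝 x := Icc_mem_nhds hx.1 hx.2
  have hd : HasDerivAt (S.h i) (S.h' i x) x := (S.hasDeriv i x hx').hasDerivAt hm
  have hI := S.maps i hx'
  refine ⟨lt_of_le_of_ne hI.1 fun h0 => ?_, lt_of_le_of_ne hI.2 fun h1 => ?_⟩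
  · refine S.nonzero i x hx' (IsLocalMin.hasDerivAt_eq_zero ?_ hd)
    filter_upwards [hm] with y hy
    rw [← h0]
    exact (S.maps i hy).1
  · refine S.nonzero i x hx' (IsLocalMax.hasDerivAt_eq_zero ?_ hd)
    filter_upwards [hm] with y hy
    rw [h1]
    exact (S.maps i hy).2

lemma continuousOn_h' (i : I) : ContinuousOn (S.h' i) (Icc 0 1) := by
  obtain ⟨C, hC, hol⟩ := S.holder
  intro x hx
  rw [ContinuousWithinAt, tendsto_iff_dist_tendsto_zero]
  have hlim : Tendsto (fun y : ℝ => C * |y - x| ^ S.αh) (𝓝[Icc 0 1] x) (𝓝 0) := by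
    have h1 : Continuous fun y : ℝ => C * |y - x| ^ S.αh :=
      continuous_const.mul ((continuous_id.sub continuous_const).abs.rpow_const
        fun _ => Or.inr S.αh_pos.le)
    have h2 := h1.tendsto x
    simp only [sub_self, abs_zero, Real.zero_rpow S.αh_pos.ne', mul_zero] at h2
    exact h2.mono_left nhdsWithin_le_nhds
  refine squeeze_zero' (Eventually.of_forall fun _ => dist_nonneg) ?_ hlim
  filter_upwards [self_mem_nhdsWithin] with y hy
  exact hol i y hy x hx

lemma abs_h'_le_one (i : I) {x : ℝ} (hx : x ∈ Icc (0 : ℝ) 1) : |S.h' i x| ≤ 1 := by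
  have hne : (𝓝[Icc (0 : ℝ) 1 \ {x}] x).NeBot :=
    accPt_principal_iff_nhdsWithin.1 (uniqueDiffOn_Icc_zero_one x hx).accPt
  refine le_of_tendsto (hasDerivWithinAt_iff_tendsto_slope.1 (S.hasDeriv i x hx)).abs ?_
  filter_upwards [self_mem_nhdsWithin] with y hy
  rw [slope_def_field, abs_div]
  exact div_le_one_of_le₀ (S.contract i y hy.1 x hx hy.2).le (abs_nonneg _)

lemma mapsTo_wMap (w : List I) : MapsTo (wMap S.h w) (Icc 0 1) (Icc 0 1) := by
  induction w with
  | nil => exact mapsTo_id _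
  | cons a t ih => exact (S.maps a).comp ih

lemma mapsTo_Ioo_wMap (w : List I) : MapsTo (wMap S.h w) (Ioo 0 1) (Ioo 0 1) := by
  induction w with
  | nil => exact mapsTo_id _
  | cons a t ih => exact (S.mapsTo_Ioo_h a).comp ih

lemma continuousOn_wMap (w : List I) : ContinuousOn (wMap S.h w) (Icc 0 1) := by
  induction w with
  | nil => exact continuousOn_id
  | cons a t ih => exact (S.continuousOn_h a).comp ih (S.mapsTo_wMap t)

lemma injOn_wMap (w : List I) : InjOn (wMap S.h w) (Icc 0 1) := by
  induction w with
  | nil => exact injOn_id _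
  | cons a t ih => exact (S.injOn_h a).comp ih (S.mapsTo_wMap t)

lemma continuousOn_wDeriv (w : List I) : ContinuousOn (wDeriv S.h S.h' w) (Icc 0 1) := by
  induction w with
  | nil => exact continuousOn_const
  | cons a t ih =>
    exact ((S.continuousOn_h' a).comp (S.continuousOn_wMap t) (S.mapsTo_wMap t)).mul ih

lemma abs_wDeriv_le_one (w : List I) {x : ℝ} (hx : x ∈ Icc (0 : ℝ) 1) :
    |wDeriv S.h S.h' w x| ≤ 1 := by
  induction w with
  | nil => simp [wDeriv]
  | cons a t ih =>
    rw [wDeriv, abs_mul]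
    exact mul_le_one₀ (S.abs_h'_le_one a (S.mapsTo_wMap t hx)) (abs_nonneg _) ih

lemma bddAbove_abs_wDeriv (w : List I) :
    BddAbove (range fun x : Icc (0 : ℝ) 1 => |wDeriv S.h S.h' w x|) := by
  refine ⟨1, ?_⟩
  rintro _ ⟨x, rfl⟩
  exact S.abs_wDeriv_le_one w x.2

lemma supD_append_le (v u : List I) : supD S.h S.h' (v ++ u) ≤ supD S.h S.h' u := by
  have : Nonempty (Icc (0 : ℝ) 1) := ⟨⟨0, by simp⟩⟩
  refine ciSup_mono (S.bddAbove_abs_wDeriv u) fun x => ?_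
  rw [wDeriv_append, abs_mul]
  exact mul_le_of_le_one_left (abs_nonneg _) (S.abs_wDeriv_le_one v (S.mapsTo_wMap u x.2))

lemma exists_one_le_abs_wDeriv {u : List I} (hu : ¬ supD S.h S.h' u < 1) :
    ∃ x ∈ Icc (0 : ℝ) 1, 1 ≤ |wDeriv S.h S.h' u x| := by
  have : Nonempty (Icc (0 : ℝ) 1) := ⟨⟨0, by simp⟩⟩
  obtain ⟨x, hx, hmax⟩ := isCompact_Icc.exists_isMaxOn (nonempty_Icc.2 (zero_le_one (α := ℝ)))
    (S.continuousOn_wDeriv u).abs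
  exact ⟨x, hx, (not_lt.1 hu).trans (ciSup_le fun y => hmax y.2)⟩

lemma exists_pos_le_abs_h' : ∃ δ > 0, ∀ i, ∀ x ∈ Icc (0 : ℝ) 1, δ ≤ |S.h' i x| := by
  have : Nonempty I := Fintype.card_pos_iff.1 (by linarith [S.card])
  have h (i : I) : ∃ x ∈ Icc (0 : ℝ) 1, ∀ y ∈ Icc (0 : ℝ) 1, |S.h' i x| ≤ |S.h' i y| :=
    isCompact_Icc.exists_isMinOn (nonempty_Icc.2 zero_le_one) (S.continuousOn_h' i).abs
  choose m hm hmin using h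
  obtain ⟨i₀, hi₀⟩ := Finite.exists_min fun i => |S.h' i (m i)|
  exact ⟨_, abs_pos.2 (S.nonzero i₀ _ (hm i₀)), fun i x hx => (hi₀ i).trans (hmin i x hx)⟩

/-- If `|h_w'|` equals one somewhere, then the length of `h_w([0,1])` is bounded below by
`c (2/3)^|w|`, with `c` independent of `w`. -/
lemma exists_pos_mul_pow_le_length : ∃ c > 0, ∀ w : List I, ∀ x ∈ Icc (0 : ℝ) 1,
    1 ≤ |wDeriv S.h S.h' w x| →
      c * (2 / 3 : ℝ) ^ w.length ≤ |wMap S.h w 1 - wMap S.h w 0| := by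
  obtain ⟨δ, hδ, hmin⟩ := S.exists_pos_le_abs_h'
  obtain ⟨C, hC, hol⟩ := S.holder
  have hC' : (0 : ℝ) < 1 / (3 * C) := by positivity
  set ε : ℝ := (1 / (3 * C)) ^ S.αh⁻¹ with hε
  have hε0 : 0 < ε := Real.rpow_pos_of_pos hC' _
  have hεC : C * ε ^ S.αh = 1 / 3 := by
    rw [hε, Real.rpow_inv_rpow hC'.le S.αh_pos.ne']
    field_simp
  refine ⟨min 1 (δ * ε), by positivity, fun w x hx hw => ?_⟩
  induction w with
  | nil => simp [wMap]
  | cons a t ih =>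
    have hxt := S.mapsTo_wMap t hx
    rw [wDeriv, abs_mul] at hw
    have ht : 1 ≤ |wDeriv S.h S.h' t x| :=
      hw.trans (mul_le_of_le_one_left (abs_nonneg _) (S.abs_h'_le_one a hxt))
    have ha : 1 ≤ |S.h' a (wMap S.h t x)| :=
      hw.trans (mul_le_of_le_one_right (abs_nonneg _) (S.abs_wDeriv_le_one t hx))
    have h0 := S.mapsTo_wMap t (left_mem_Icc.2 zero_le_one)
    have h1 := S.mapsTo_wMap t (right_mem_Icc.2 zero_le_one)
    obtain ⟨z, hz, hmv⟩ := exists_mem_uIcc_abs_sub_eq (S.hasDeriv a) h0 h1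
    have hzI : z ∈ Icc (0 : ℝ) 1 := uIcc_subset_Icc h0 h1 hz
    change _ ≤ |S.h a (wMap S.h t 1) - S.h a (wMap S.h t 0)|
    rw [hmv]
    set l := |wMap S.h t 1 - wMap S.h t 0|
    rcases le_total l ε with hl | hl
    · have hxu : wMap S.h t x ∈ uIcc (wMap S.h t 0) (wMap S.h t 1) :=
        (image_subset_uIcc_and_uIoo_subset_image (S.continuousOn_wMap t) (S.injOn_wMap t)).1
          (mem_image_of_mem _ hx)
      have hdist : |wMap S.h t x - z| ≤ ε :=
        (abs_sub_le_of_uIcc_subset_uIcc (uIcc_subset_uIcc hz hxu)).trans hl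
      have hh : |S.h' a (wMap S.h t x) - S.h' a z| ≤ 1 / 3 := by
        refine (hol a _ hxt z hzI).trans (hεC ▸ ?_)
        gcongr
        exact S.αh_pos.le
      have h23 : 2 / 3 ≤ |S.h' a z| := by
        linarith [abs_sub_abs_le_abs_sub (S.h' a (wMap S.h t x)) (S.h' a z)]
      calc min 1 (δ * ε) * (2 / 3 : ℝ) ^ (a :: t).length
          = 2 / 3 * (min 1 (δ * ε) * (2 / 3 : ℝ) ^ t.length) := by
            rw [List.length_cons, pow_succ]; ring
        _ ≤ |S.h' a z| * l := by gcongr; exact ih ht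
    · calc min 1 (δ * ε) * (2 / 3 : ℝ) ^ (a :: t).length
          ≤ min 1 (δ * ε) * 1 := by
            gcongr
            exact pow_le_one₀ (by norm_num) (by norm_num)
        _ ≤ δ * ε := by rw [mul_one]; exact min_le_right _ _
        _ ≤ |S.h' a z| * l := by gcongr; exact hmin a z hzI

lemma disjoint_image_wMap {w w' : List I} (hlen : w.length = w'.length) (hne : w ≠ w') :
    Disjoint (wMap S.h w '' Ioo 0 1) (wMap S.h w' '' Ioo 0 1) := by
  induction w generalizing w' with
  | nil => exact absurd (List.length_eq_zero_iff.1 hlen.symm).symm hne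
  | cons a t ih =>
    obtain _ | ⟨b, s⟩ := w'
    · simp at hlen
    have ht := S.mapsTo_Ioo_wMap t
    have hs := S.mapsTo_Ioo_wMap s
    simp only [wMap, image_comp]
    by_cases hab : a = b
    · subst hab
      have hdisj := ih (w' := s) (by simpa using hlen) (by simpa using hne)
      rw [Set.disjoint_iff_inter_eq_empty] at hdisj ⊢
      rw [← (S.injOn_h a).image_inter (ht.image_subset.trans Ioo_subset_Icc_self)
        (hs.image_subset.trans Ioo_subset_Icc_self), hdisj, image_empty]
    · exact (S.sep a b hab).mono (image_mono ht.image_subset) (image_mono hs.image_subset)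

lemma sum_length_le_one (n : ℕ) :
    ∑ w : List.Vector I n, |wMap S.h w.toList 1 - wMap S.h w.toList 0| ≤ 1 := by
  have hsub (w : List I) : uIoo (wMap S.h w 0) (wMap S.h w 1) ⊆ wMap S.h w '' Ioo 0 1 :=
    (image_subset_uIcc_and_uIoo_subset_image (S.continuousOn_wMap w) (S.injOn_wMap w)).2
  have hvol (a b : ℝ) : volume (uIoo a b) = ENNReal.ofReal |b - a| := by
    rw [uIoo, Real.volume_Ioo, max_sub_min_eq_abs]
  have hU : volume (⋃ w ∈ (Finset.univ : Finset (List.Vector I n)),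
      uIoo (wMap S.h w.toList 0) (wMap S.h w.toList 1)) ≤ volume (Ioo (0 : ℝ) 1) :=
    measure_mono (iUnion₂_subset fun w _ =>
      (hsub w.toList).trans (S.mapsTo_Ioo_wMap w.toList).image_subset)
  rw [measure_biUnion_finset] at hU
  · simp only [hvol, Real.volume_Ioo, sub_zero] at hU
    rw [← ENNReal.ofReal_sum_of_nonneg fun _ _ => abs_nonneg _] at hU
    exact (ENNReal.ofReal_le_ofReal_iff zero_le_one).1 hU
  · intro w _ w' _ hne
    exact (S.disjoint_image_wMap (by simp) fun h => hne (List.Vector.toList_injective h)).mono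
      (hsub _) (hsub _)
  · exact fun _ _ => measurableSet_Ioo

end PCantorIFS

/-- The semigroup generated by a parabolic Cantor IFS contains a uniformly
hyperbolic map `h_{i₀}`, `i₀ ∈ I^*`; consequently `sup_{j ∈ I^*} ‖h_{j i₀}'‖_∞ ≤ ‖h_{i₀}'‖_∞ < 1`.
(Since the attractor is not a single point, there are two finite words whose fixed points
are distinct; this is taken as a hypothesis.) -/
theorem exists_hyperbolic_word {I : Type} [Fintype I]
    (S : PCantorIFS I)
    (hfix : ∃ u v : List I, u ≠ [] ∧ v ≠ [] ∧ ∃ p ∈ Icc (0:ℝ) 1, ∃ p' ∈ Icc (0:ℝ) 1,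
      wMap S.h u p = p ∧ wMap S.h v p' = p' ∧ p ≠ p') :
    ∃ u : List I, u ≠ [] ∧ supD S.h S.h' u < 1 ∧
      ∀ v : List I, supD S.h S.h' (v ++ u) ≤ supD S.h S.h' u := by
  suffices h : ∃ u : List I, u ≠ [] ∧ supD S.h S.h' u < 1 by
    obtain ⟨u, hu, hlt⟩ := h
    exact ⟨u, hu, hlt, fun v => S.supD_append_le v u⟩
  by_contra! hcon
  obtain ⟨c, hc, hlow⟩ := S.exists_pos_mul_pow_le_length
  obtain ⟨n, hn⟩ := pow_unbounded_of_one_lt c⁻¹ (show (1 : ℝ) < 4 / 3 by norm_num)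
  have hlen (w : List.Vector I (n + 1)) :
      c * (2 / 3 : ℝ) ^ (n + 1) ≤ |wMap S.h w.toList 1 - wMap S.h w.toList 0| := by
    have hne : w.toList ≠ [] := List.ne_nil_of_length_pos (by simp)
    obtain ⟨x, hx, h1⟩ := S.exists_one_le_abs_wDeriv (not_lt.2 (hcon _ hne))
    simpa using hlow w.toList x hx h1
  have hsum := (Finset.card_nsmul_le_sum Finset.univ _ _ fun w _ => hlen w).trans
    (S.sum_length_le_one (n + 1))
  rw [Finset.card_univ, card_vector, nsmul_eq_mul, Nat.cast_pow] at hsum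
  have hcard : (2 : ℝ) ^ (n + 1) ≤ (Fintype.card I : ℝ) ^ (n + 1) := by
    gcongr
    exact_mod_cast S.card
  have hcontra : (4 / 3 : ℝ) ^ (n + 1) * c ≤ 1 := by
    calc (4 / 3 : ℝ) ^ (n + 1) * c = 2 ^ (n + 1) * (c * (2 / 3 : ℝ) ^ (n + 1)) := by
          rw [show (4 / 3 : ℝ) = 2 * (2 / 3) by norm_num, mul_pow]; ring
      _ ≤ (Fintype.card I : ℝ) ^ (n + 1) * (c * (2 / 3 : ℝ) ^ (n + 1)) := by gcongr
      _ ≤ 1 := hsum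
  have hgrow : (4 / 3 : ℝ) ^ n ≤ (4 / 3 : ℝ) ^ (n + 1) :=
    pow_le_pow_right₀ (by norm_num) n.le_succ
  have hbig : 1 < (4 / 3 : ℝ) ^ (n + 1) * c := by
    rw [← inv_mul_cancel₀ hc.ne']
    gcongr
    exact hn.trans_le hgrow
  exact absurd hcontra (not_le.2 hbig)
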